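/- Let n, k ∈ ℕ, let A ∈ ℝ^{2n×2k} be symplectic (Aᵀ J_{2n} A = J_{2k}) with A⁺ := J_{2k}ᵀ Aᵀ J_{2n}, and let u, v ∈ ℝ^{2n} with v vertical (v = (0, f) for some f ∈ ℝ^n). Then (A⁺ u)ᵀ J_{2k} (A⁺ v) = uᵀ J_{2n} v holds under either of the following conditions: (d) A_qp = 0 and the second n-block of A A⁺ v equals the second n-block of v; or (e) the first n-block of A A⁺ u equals the first n-block of u. -/

import Mathlib

open Matrix

/-- The `2m × 2m` Poisson matrix `[[0, I], [-I, 0]]`, indexed by `Fin m ⊕ Fin m`. -/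
noncomputable def Jmat (m : ℕ) : Matrix (Fin m ⊕ Fin m) (Fin m ⊕ Fin m) ℝ :=
  Matrix.fromBlocks 0 1 (-1) 0

theorem Jmat_mulVec_elim (m : ℕ) (a b : Fin m → ℝ) :
    Jmat m *ᵥ Sum.elim a b = Sum.elim b (-a) := by
  simp [Jmat, Matrix.fromBlocks_mulVec, Matrix.neg_mulVec]

theorem Jmat_transpose (m : ℕ) : (Jmat m)ᵀ = -Jmat m := by
  simp [Jmat, Matrix.fromBlocks_transpose, Matrix.fromBlocks_neg]

theorem Jmat_mul_self (m : ℕ) : Jmat m * Jmat m = -1 := by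
  rw [Jmat, Matrix.fromBlocks_multiply, ← Matrix.fromBlocks_one, Matrix.fromBlocks_neg]
  simp

/-- The symplectic inverse `A⁺` is the adjoint of `A`: `ω(x, A⁺ v) = Ω(A x, v)`. -/
theorem dotProduct_Jmat_symplecticInverse {n k : ℕ}
    (A : Matrix (Fin n ⊕ Fin n) (Fin k ⊕ Fin k) ℝ) (x : Fin k ⊕ Fin k → ℝ)
    (v : Fin n ⊕ Fin n → ℝ) :
    x ⬝ᵥ Jmat k *ᵥ (((Jmat k)ᵀ * Aᵀ * Jmat n) *ᵥ v) = (A *ᵥ x) ⬝ᵥ Jmat n *ᵥ v := by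
  have h : Jmat k * ((Jmat k)ᵀ * Aᵀ * Jmat n) = Aᵀ * Jmat n := by
    rw [Matrix.mul_assoc, ← Matrix.mul_assoc, Jmat_transpose, Matrix.mul_neg, Jmat_mul_self,
      neg_neg, Matrix.one_mul]
  rw [Matrix.mulVec_mulVec, h, ← Matrix.mulVec_mulVec, Matrix.dotProduct_mulVec,
    Matrix.vecMul_transpose]

theorem dotProduct_Jmat_antisymm {m : ℕ} (x y : Fin m ⊕ Fin m → ℝ) :
    x ⬝ᵥ Jmat m *ᵥ y = -(y ⬝ᵥ Jmat m *ᵥ x) := by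
  rw [Matrix.dotProduct_mulVec, ← Matrix.mulVec_transpose, Jmat_transpose, Matrix.neg_mulVec,
    neg_dotProduct, dotProduct_comm]

/-- If `A_qp = 0`, then `A A⁺` maps vertical vectors to vertical vectors. -/
theorem mulVec_symplecticInverse_vertical_inl {n k : ℕ} (Aqq Apq App : Matrix (Fin n) (Fin k) ℝ)
    (f : Fin n → ℝ) (i : Fin n) :
    (Matrix.fromBlocks Aqq 0 Apq App *ᵥ
      (((Jmat k)ᵀ * (Matrix.fromBlocks Aqq 0 Apq App)ᵀ * Jmat n) *ᵥ Sum.elim 0 f))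
        (Sum.inl i) = 0 := by
  have h : (Matrix.fromBlocks Aqq 0 Apq App)ᵀ *ᵥ Sum.elim f 0 = Sum.elim (Aqqᵀ *ᵥ f) 0 := by
    simp [Matrix.fromBlocks_transpose, Matrix.fromBlocks_mulVec]
  rw [← Matrix.mulVec_mulVec, ← Matrix.mulVec_mulVec, Jmat_mulVec_elim, neg_zero, h,
    Jmat_transpose, Matrix.neg_mulVec, Jmat_mulVec_elim, Matrix.mulVec_neg,
    Matrix.fromBlocks_mulVec]
  simp

/-- For symplectic `A = [[A_qq, A_qp], [A_pq, A_pp]]` with `A⁺ := J_{2k}ᵀ Aᵀ J_{2n}`,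
a vertical `v = (0, f)`, and any `u`, the reduced pairing `ω(A⁺u, A⁺v)` equals
`Ω(u, v)` provided either
(d) `A_qp = 0` and the second `n`-block of `AA⁺v` equals that of `v`, or
(e) the first `n`-block of `AA⁺u` equals that of `u`. -/
theorem stmt11 (n k : ℕ) (Aqq Aqp Apq App : Matrix (Fin n) (Fin k) ℝ)
    (hA : (Matrix.fromBlocks Aqq Aqp Apq App)ᵀ * Jmat n *
        Matrix.fromBlocks Aqq Aqp Apq App = Jmat k)
    (u : Fin n ⊕ Fin n → ℝ) (f : Fin n → ℝ)
    (v : Fin n ⊕ Fin n → ℝ) (hv : v = Sum.elim (0 : Fin n → ℝ) f)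
    (hcond :
      (Aqp = 0 ∧ ∀ i : Fin n,
        ((Matrix.fromBlocks Aqq Aqp Apq App).mulVec
            (((Jmat k)ᵀ * (Matrix.fromBlocks Aqq Aqp Apq App)ᵀ * Jmat n).mulVec v))
          (Sum.inr i) = v (Sum.inr i)) ∨
      (∀ i : Fin n,
        ((Matrix.fromBlocks Aqq Aqp Apq App).mulVec
            (((Jmat k)ᵀ * (Matrix.fromBlocks Aqq Aqp Apq App)ᵀ * Jmat n).mulVec u))
          (Sum.inl i) = u (Sum.inl i))) :
    ((((Jmat k)ᵀ * (Matrix.fromBlocks Aqq Aqp Apq App)ᵀ * Jmat n).mulVec u) ⬝ᵥ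
        (Jmat k).mulVec
          (((Jmat k)ᵀ * (Matrix.fromBlocks Aqq Aqp Apq App)ᵀ * Jmat n).mulVec v))
      = u ⬝ᵥ (Jmat n).mulVec v := by
  rcases hcond with ⟨rfl, hd⟩ | he
  · have hfix : Matrix.fromBlocks Aqq 0 Apq App *ᵥ
        (((Jmat k)ᵀ * (Matrix.fromBlocks Aqq 0 Apq App)ᵀ * Jmat n) *ᵥ v) = v := by
      ext (i | i)
      · subst hv
        exact mulVec_symplecticInverse_vertical_inl Aqq Apq App f i
      · exact hd i
    rw [dotProduct_Jmat_antisymm, dotProduct_Jmat_symplecticInverse, hfix,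
      ← dotProduct_Jmat_antisymm]
  · rw [dotProduct_Jmat_symplecticInverse, hv, Jmat_mulVec_elim]
    simp only [dotProduct, Fintype.sum_sum_type, he, Sum.elim_inl, Sum.elim_inr, neg_zero,
      Pi.zero_apply, mul_zero]
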